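/- arXiv:2012.11166 — 2 statements merged into one kernel-verified Lean document; each statement's English description precedes it below -/
import Mathlib

section
/- Let s ≥ 1, 1 ≤ r ≤ m−1, let a be a common divisor of m and d with d ≥ 1, and let U ⊆ F_{q^m} be an F_{q^a}-linear subspace of F_{q^a}-dimension d/a (so U has F_q-dimension d). Then |bad(U)| < q^{d(m−r)−ms} · q^{m(m−r)} / (q^a − 1) (an inequality of real numbers). -/
open Finset

/-- `bad(U)`: the set of `x ∈ Ω` for which there is a not-all-zero tuple `u` with entries in `U`
such that `∑ⱼ uⱼ^{q^ℓ} xⱼ = 0` for all `1 ≤ ℓ ≤ s`. -/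
def badSet (F : Type*) {E : Type*} [Field F] [Field E] [Algebra F E]
    (q s k : ℕ) (U : Set E) : Set (Fin k → E) :=
  {x | LinearIndependent F x ∧ ∃ u : Fin k → E, (∀ j, u j ∈ U) ∧ u ≠ 0 ∧
      ∀ ℓ : ℕ, 1 ≤ ℓ → ℓ ≤ s → ∑ j, u j ^ q ^ ℓ * x j = 0}

section FrobeniusPowers

variable {F E : Type*} [Field F] [Fintype F] [Field E] [Algebra F E]

theorem frobeniusAlgHom_pow_apply (n : ℕ) (x : E) :
    (FiniteField.frobeniusAlgHom F E ^ n) x = x ^ Fintype.card F ^ n := by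
  induction n generalizing x with
  | zero => simp
  | succ n ih =>
    rw [pow_succ, AlgHom.mul_apply, ih, FiniteField.coe_frobeniusAlgHom, ← pow_mul, ← pow_succ']

variable [Fintype E]

/-- The Frobenius powers `x ↦ x ^ q ^ (i + 1)`, `i < s`, are linearly independent over `E` on an
`F`-subspace of dimension at least `s`. -/
theorem eq_zero_of_sum_mul_pow_card_pow_eq_zero {s : ℕ} (W : Submodule F E)
    (hW : s ≤ Module.finrank F W) (c : Fin s → E)
    (hc : ∀ w ∈ W, ∑ i, c i * w ^ Fintype.card F ^ ((i : ℕ) + 1) = 0) : c = 0 := by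
  classical
  have hq : 1 < Fintype.card F := Fintype.one_lt_card
  choose b hb using fun i => (FiniteField.frobeniusAlgEquivOfAlgebraic F E).surjective (c i)
  have hb' : ∀ i, b i ^ Fintype.card F = c i := hb
  let p : Polynomial E := ∑ i, Polynomial.C (b i) * Polynomial.X ^ Fintype.card F ^ (i : ℕ)
  have hp : p = 0 := by
    refine Polynomial.eq_zero_of_natDegree_lt_card_of_eval_eq_zero' p (W : Set E).toFinset ?_ ?_
    · intro w hw
      have h := hc w (by simpa using hw)
      have h2 : (FiniteField.frobeniusAlgHom F E) (p.eval w) = 0 := by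
        rw [← h, Polynomial.eval_finsetSum, map_sum]
        refine Finset.sum_congr rfl fun i _ => ?_
        simp only [Polynomial.eval_mul, Polynomial.eval_C, Polynomial.eval_pow, Polynomial.eval_X,
          FiniteField.coe_frobeniusAlgHom, mul_pow, hb', pow_succ, pow_mul]
      exact (map_eq_zero _).1 h2
    · have hcard : (W : Set E).toFinset.card = Fintype.card F ^ Module.finrank F W := by
        rw [Set.toFinset_card]
        exact Module.card_eq_pow_finrank (K := F) (V := W)
      rw [hcard]
      refine lt_of_lt_of_le ?_ (Nat.pow_le_pow_right hq.le hW)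
      rw [← Nat.le_sub_one_iff_lt (by positivity)]
      refine Polynomial.natDegree_sum_le_of_forall_le _ _ fun i _ => ?_
      refine (Polynomial.natDegree_C_mul_X_pow_le _ _).trans (Nat.le_sub_one_of_lt ?_)
      exact Nat.pow_lt_pow_right hq i.2
  funext i
  have h : p.coeff (Fintype.card F ^ (i : ℕ)) = b i := by
    simp only [p, Polynomial.finsetSum_coeff, Polynomial.coeff_C_mul, Polynomial.coeff_X_pow,
      (Nat.pow_right_injective hq).eq_iff, Fin.val_inj]
    simp
  rw [← hb' i, ← h, hp]
  simp

theorem eq_zero_of_sum_mul_pow_card_pow_eq_zero_of_le_finrank_span {ι : Type*} {s : ℕ} (u : ι → E)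
    (hu : s ≤ Module.finrank F (Submodule.span F (Set.range u))) (c : Fin s → E)
    (hc : ∀ j, ∑ i, c i * u j ^ Fintype.card F ^ ((i : ℕ) + 1) = 0) : c = 0 := by
  refine eq_zero_of_sum_mul_pow_card_pow_eq_zero _ hu c fun w hw => ?_
  let L : E →ₗ[F] E := ∑ i, LinearMap.mulLeft F (c i) ∘ₗ
    (FiniteField.frobeniusAlgHom F E ^ ((i : ℕ) + 1)).toLinearMap
  have hL : ∀ w, L w = ∑ i, c i * w ^ Fintype.card F ^ ((i : ℕ) + 1) := fun w => by
    simp only [L, LinearMap.sum_apply, LinearMap.comp_apply, LinearMap.mulLeft_apply,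
      AlgHom.toLinearMap_apply, frobeniusAlgHom_pow_apply]
  rw [← hL]
  refine (Submodule.span_le (p := LinearMap.ker L)).2 ?_ hw
  rintro _ ⟨j, rfl⟩
  rw [SetLike.mem_coe, LinearMap.mem_ker, hL, hc]

/-- The Moore matrix of a linearly independent family is nonsingular. -/
theorem LinearIndependent.eq_zero_of_sum_pow_card_pow_mul_eq_zero {t : ℕ} {v : Fin t → E}
    (hv : LinearIndependent F v) (y : Fin t → E)
    (h : ∀ l : Fin t, ∑ i, v i ^ Fintype.card F ^ ((l : ℕ) + 1) * y i = 0) : y = 0 := by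
  by_contra hy
  let M : Matrix (Fin t) (Fin t) E := .of fun l i => v i ^ Fintype.card F ^ ((l : ℕ) + 1)
  obtain ⟨c, hc0, hc⟩ := Matrix.exists_vecMul_eq_zero_iff.2
    (Matrix.exists_mulVec_eq_zero_iff.1 ⟨y, hy, (funext h : M.mulVec y = 0)⟩)
  exact hc0 (eq_zero_of_sum_mul_pow_card_pow_eq_zero_of_le_finrank_span v
    (by rw [finrank_span_eq_card hv, Fintype.card_fin]) c (congrFun hc))

theorem le_finrank_span_of_sum_pow_card_pow_mul_eq_zero {k s : ℕ} {u x : Fin k → E} (hu : u ≠ 0)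
    (hx : LinearIndependent F x)
    (h : ∀ l < s, ∑ j, u j ^ Fintype.card F ^ (l + 1) * x j = 0) :
    s ≤ Module.finrank F (Submodule.span F (Set.range u)) := by
  by_contra! hs
  let b := Module.finBasis F (Submodule.span F (Set.range u))
  let w : Fin k → Submodule.span F (Set.range u) :=
    fun j => ⟨u j, Submodule.subset_span ⟨j, rfl⟩⟩
  have hw : ∀ j, u j = ∑ i, b.repr (w j) i • (b i : E) := fun j => by
    have := congrArg Subtype.val (b.sum_repr (w j))
    simpa only [AddSubmonoidClass.coe_finsetSum, Submodule.coe_smul] using this.symm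
  have hb : LinearIndependent F fun i => (b i : E) :=
    b.linearIndependent.map' (Submodule.subtype _) (Submodule.ker_subtype _)
  have hy := hb.eq_zero_of_sum_pow_card_pow_mul_eq_zero (fun i => ∑ j, b.repr (w j) i • x j)
    fun l => by
      rw [← h l (l.2.trans hs)]
      simp only [← frobeniusAlgHom_pow_apply]
      simp_rw [hw, map_sum, map_smul, Finset.sum_mul, Finset.mul_sum]
      rw [Finset.sum_comm]
      simp
  refine hu (funext fun j => ?_)
  rw [hw j]
  refine Finset.sum_eq_zero fun i _ => ?_
  rw [Fintype.linearIndependent_iff.1 hx (fun j => b.repr (w j) i) (congrFun hy i) j, zero_smul]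

theorem card_filter_linearIndependent_mul_le {k s : ℕ} {u : Fin k → E} (hu : u ≠ 0)
    [DecidablePred fun x : Fin k → E => LinearIndependent F x ∧
      ∀ l < s, ∑ j, u j ^ Fintype.card F ^ (l + 1) * x j = 0] :
    (univ.filter fun x : Fin k → E => LinearIndependent F x ∧
      ∀ l < s, ∑ j, u j ^ Fintype.card F ^ (l + 1) * x j = 0).card * Fintype.card E ^ s ≤
      Fintype.card E ^ k := by
  classical
  by_cases hs : s ≤ Module.finrank F (Submodule.span F (Set.range u))
  · let M : Matrix (Fin s) (Fin k) E := .of fun l j => u j ^ Fintype.card F ^ ((l : ℕ) + 1)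
    have hM : M.rank = s := by
      rw [LinearIndependent.rank_matrix, Fintype.card_fin]
      rw [Fintype.linearIndependent_iff]
      intro c hc
      exact congrFun (eq_zero_of_sum_mul_pow_card_pow_eq_zero_of_le_finrank_span u hs c
        fun j => by simpa [M] using congrFun hc j)
    have hker := LinearMap.finrank_range_add_finrank_ker M.mulVecLin
    rw [show Module.finrank E (LinearMap.range M.mulVecLin) = s from hM, Module.finrank_fin_fun]
      at hker
    have hcard := Module.card_eq_pow_finrank (K := E) (V := LinearMap.ker M.mulVecLin)
    rw [show Fintype.card E ^ k = Fintype.card (LinearMap.ker M.mulVecLin) * Fintype.card E ^ s by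
      rw [hcard, ← pow_add, add_comm, hker], Fintype.card_subtype]
    refine Nat.mul_le_mul_right _ (Finset.card_le_card fun x hx => ?_)
    simp only [Finset.mem_filter, Finset.mem_univ, true_and] at hx ⊢
    exact funext fun l => hx.2 l l.2
  · rw [Finset.filter_false_of_mem, Finset.card_empty, zero_mul]
    · exact Nat.zero_le _
    · rintro x - ⟨hx, h⟩
      exact hs (le_finrank_span_of_sum_pow_card_pow_mul_eq_zero hu hx h)

end FrobeniusPowers

/-- Every `x ∈ bad(U)` has at least `|Fa| - 1` witnesses, the `Fa`-multiples of any one of them. -/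
theorem ncard_badSet_mul_lt {F Fa E : Type*} [Field F] [Fintype F] [Field Fa] [Fintype Fa]
    [Field E] [Fintype E] [Algebra Fa E] [Algebra F E] (s k : ℕ)
    (U : Submodule Fa E) :
    (badSet F (Fintype.card F) s k (U : Set E)).ncard * (Fintype.card Fa - 1) *
      Fintype.card E ^ s < Nat.card U ^ k * Fintype.card E ^ k := by
  classical
  let r : (Fin k → E) → (Fin k → U) → Prop := fun x u => LinearIndependent F x ∧
    ∀ l < s, ∑ j, (u j : E) ^ Fintype.card F ^ (l + 1) * x j = 0
  have key := Finset.card_mul_le_card_mul r (s := (badSet F (Fintype.card F) s k U).toFinset)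
    (t := univ.erase 0) (m := Fintype.card Fa - 1)
    (n := Fintype.card E ^ k / Fintype.card E ^ s) ?_ ?_
  · rw [← Set.ncard_eq_toFinset_card', Finset.card_erase_of_mem (Finset.mem_univ _),
      Finset.card_univ, Fintype.card_fun, Fintype.card_fin, ← Nat.card_eq_fintype_card (α := U)]
      at key
    have hU : 0 < Nat.card U := Nat.card_pos
    have hE : 0 < Fintype.card E := Fintype.card_pos
    calc _ ≤ (Nat.card U ^ k - 1) * (Fintype.card E ^ k / Fintype.card E ^ s) *
          Fintype.card E ^ s := Nat.mul_le_mul_right _ key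
      _ ≤ (Nat.card U ^ k - 1) * Fintype.card E ^ k := by
        rw [mul_assoc]
        exact Nat.mul_le_mul_left _ (Nat.div_mul_le_self _ _)
      _ < _ := Nat.mul_lt_mul_of_pos_right (Nat.sub_lt (by positivity) one_pos) (by positivity)
  · intro x hx
    rw [Set.mem_toFinset] at hx
    obtain ⟨hx, u, huU, hu, h⟩ := hx
    let v : Fin k → U := fun j => ⟨u j, huU j⟩
    have hv : v ≠ 0 := fun h0 => hu (funext fun j => congrArg Subtype.val (congrFun h0 j))
    rw [← Finset.card_univ, ← Finset.card_erase_of_mem (Finset.mem_univ (0 : Fa))]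
    refine Finset.card_le_card_of_injOn (fun c => c • v) ?_
      (smul_left_injective Fa hv).injOn
    intro c hc
    have hc0 : c ≠ 0 := by simpa using hc
    simp only [Finset.coe_bipartiteAbove, Set.mem_ofPred_eq, Finset.mem_erase, Finset.mem_univ]
    refine ⟨⟨smul_ne_zero hc0 hv, trivial⟩, hx, fun l hl => ?_⟩
    simp only [Pi.smul_apply, SetLike.val_smul, smul_pow, smul_mul_assoc, ← Finset.smul_sum, v]
    rw [h (l + 1) (by lia) (by lia), smul_zero]
  · intro u hu
    have hu0 : (fun j => (u j : E)) ≠ 0 := fun h0 =>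
      (Finset.mem_erase.1 hu).1 (funext fun j => Subtype.ext (congrFun h0 j))
    rw [Nat.le_div_iff_mul_le (pow_pos Fintype.card_pos _)]
    refine le_trans (Nat.mul_le_mul_right _ (Finset.card_le_card ?_))
      (card_filter_linearIndependent_mul_le (F := F) (s := s) hu0)
    intro x hx
    simpa using ((Finset.mem_bipartiteBelow r).1 hx).2

/-- If `a` is a common divisor of `m` and `d`, `d ≥ 1`, and `U ⊆ F_{q^m}` is an
`F_{q^a}`-subspace of `F_{q^a}`-dimension `d/a` (so of `F_q`-dimension `d`), then
`|bad(U)| < q^{d(m-r) - ms} · q^{m(m-r)} / (q^a - 1)` (as real numbers). -/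
theorem stmt_4 {F Fa E : Type*} [Field F] [Fintype F] [Field Fa] [Fintype Fa]
    [Field E] [Fintype E] [Algebra F Fa] [Algebra Fa E] [Algebra F E] [IsScalarTower F Fa E]
    (q m s r a d : ℕ) (hq : Fintype.card F = q) (hm : Module.finrank F E = m)
    (hqa : Fintype.card Fa = q ^ a)
    (hs : 1 ≤ s) (hr1 : 1 ≤ r) (hrm : r ≤ m - 1) (hd : 1 ≤ d) (ham : a ∣ m) (had : a ∣ d)
    (U : Submodule Fa E) (hUa : Module.finrank Fa U = d / a) (hUd : Module.finrank F U = d) :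
    ((badSet F q s (m - r) (U : Set E)).ncard : ℝ) <
      (q : ℝ) ^ (((d * (m - r) : ℕ) : ℤ) - ((m * s : ℕ) : ℤ)) * (q : ℝ) ^ (m * (m - r)) /
        ((q : ℝ) ^ a - 1) := by
  subst hq
  have hE : Fintype.card E = Fintype.card F ^ m := by
    rw [← hm]; exact Module.card_eq_pow_finrank
  have hU : Nat.card U = Fintype.card F ^ d := by
    rw [← hUd, ← Nat.card_eq_fintype_card]
    exact Module.natCard_eq_pow_finrank
  have key := ncard_badSet_mul_lt (F := F) s (m - r) U
  have ha : 1 < Fintype.card F ^ a := hqa ▸ Fintype.one_lt_card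
  have hq : (0 : ℝ) < Fintype.card F := by exact_mod_cast Fintype.card_pos
  have ha' : (1 : ℝ) < (Fintype.card F : ℝ) ^ a := by exact_mod_cast ha
  rw [hE, hU, hqa, ← pow_mul, ← pow_mul, ← pow_mul] at key
  rw [lt_div_iff₀ (by linarith), zpow_sub₀ hq.ne', zpow_natCast, zpow_natCast, div_mul_eq_mul_div,
    lt_div_iff₀ (by positivity)]
  have h := (Nat.cast_lt (α := ℝ)).2 key
  push_cast [Nat.cast_sub ha.le] at h
  exact h
end

section
/- Assume q = 2, 1 ≤ s < d ≤ m, 2 ≤ r ≤ m, and ms ≥ d(m−r) + 1. Then for every F_2-linear subspace U ⊆ F_{2^m} of dimension d there exists an F_2-linear subspace V ⊆ F_{2^m} of dimension r such that the pair (U,V) is good. -/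
open Finset

/-- The trace-dual of an `F`-subspace `V` of `E`, where `Tr(x) = ∑_{i<m} x^{q^i}`:
`V^⊥ = {x : ∀ v ∈ V, Tr(v*x) = 0}`. -/
def traceDual {F E : Type*} [Field F] [Fintype F] [Field E] [Fintype E] [Algebra F E]
    (q m : ℕ) (hq : Fintype.card F = q) (V : Submodule F E) : Submodule F E where
  carrier := {x : E | ∀ v ∈ V, ∑ i ∈ Finset.range m, (v * x) ^ q ^ i = 0}
  zero_mem' := by
    intro v hv
    have hq0 : q ≠ 0 := by
      have h1 : 0 < Fintype.card F := Fintype.card_pos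
      omega
    refine Finset.sum_eq_zero fun i _ => ?_
    rw [mul_zero, zero_pow (pow_ne_zero i hq0)]
  add_mem' := by
    intro x y hx hy v hv
    obtain ⟨n, hp, hcard⟩ := FiniteField.card F (ringChar F)
    haveI : Fact (Nat.Prime (ringChar F)) := ⟨hp⟩
    haveI : CharP E (ringChar F) :=
      charP_of_injective_algebraMap (algebraMap F E).injective (ringChar F)
    have hq' : q = ringChar F ^ (n : ℕ) := by rw [← hq, hcard]
    have key : ∀ a b : E, ∀ i : ℕ, (a + b) ^ q ^ i = a ^ q ^ i + b ^ q ^ i := by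
      intro a b i
      rw [hq', ← pow_mul]
      exact add_pow_char_pow a b (ringChar F) ((n : ℕ) * i)
    calc ∑ i ∈ Finset.range m, (v * (x + y)) ^ q ^ i
        = ∑ i ∈ Finset.range m, ((v * x) ^ q ^ i + (v * y) ^ q ^ i) := by
          refine Finset.sum_congr rfl fun i _ => ?_
          rw [mul_add, key]
      _ = 0 := by rw [Finset.sum_add_distrib, hx v hv, hy v hv, add_zero]
  smul_mem' := by
    intro c x hx v hv
    have hc : ∀ i : ℕ, (algebraMap F E c) ^ q ^ i = algebraMap F E c := by
      intro i
      rw [← map_pow]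
      congr 1
      calc c ^ q ^ i = c ^ Fintype.card F ^ i := by rw [hq]
        _ = c := FiniteField.pow_card_pow i c
    calc ∑ i ∈ Finset.range m, (v * (c • x)) ^ q ^ i
        = ∑ i ∈ Finset.range m, algebraMap F E c * (v * x) ^ q ^ i := by
          refine Finset.sum_congr rfl fun i _ => ?_
          rw [Algebra.smul_def, mul_left_comm, mul_pow, hc]
      _ = algebraMap F E c * ∑ i ∈ Finset.range m, (v * x) ^ q ^ i := (Finset.mul_sum _ _ _).symm
      _ = 0 := by rw [hx v hv, mul_zero]

/-- A pair `(U, V)` of `F`-subspaces of `E` is *good* (for the parameter `s`) if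
`m·s ≥ dim U · (m - dim V)` and for every `F`-basis `u₁, …, u_{dim U}` of `U` and all
`v'ᵢ ∈ V^⊥`: if `∑ᵢ v'ᵢ · uᵢ^{q^ℓ} = 0` for every `1 ≤ ℓ ≤ s`, then all `v'ᵢ = 0`. -/
def IsGoodPair {F E : Type*} [Field F] [Fintype F] [Field E] [Fintype E] [Algebra F E]
    (q m s : ℕ) (hq : Fintype.card F = q) (U V : Submodule F E) : Prop :=
  m * s ≥ Module.finrank F U * (m - Module.finrank F V) ∧
  ∀ u : Fin (Module.finrank F U) → E,
    (∀ i, u i ∈ U) → LinearIndependent F u → Submodule.span F (Set.range u) = U →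
  ∀ v' : Fin (Module.finrank F U) → E,
    (∀ i, v' i ∈ traceDual q m hq V) →
    (∀ ℓ : ℕ, 1 ≤ ℓ → ℓ ≤ s → ∑ i, v' i * u i ^ q ^ ℓ = 0) →
    ∀ i, v' i = 0

open scoped Matrix

open Polynomial in
theorem eq_zero_of_linearized_vanish {F E : Type*} [Field F] [Fintype F] [Field E] [Fintype E]
    [Algebra F E] (L : Submodule F E) {s : ℕ} (hs : s ≤ Module.finrank F L) (y : Fin s → E)
    (hy : ∀ x ∈ L, ∑ ℓ, y ℓ * x ^ Fintype.card F ^ (ℓ.1 + 1) = 0) : y = 0 := by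
  classical
  have hq : 1 < Fintype.card F := Fintype.one_lt_card
  let P : E[X] := ∑ ℓ : Fin s, C (y ℓ) * X ^ Fintype.card F ^ ℓ.1
  have hP : P = 0 := by
    refine eq_zero_of_natDegree_lt_card_of_eval_eq_zero P
      (f := fun x : L => (x : E) ^ Fintype.card F) ?_ ?_ ?_
    · intro a b h
      have h' : FiniteField.frobeniusAlgHom F E a = FiniteField.frobeniusAlgHom F E b := h
      exact Subtype.ext ((FiniteField.frobeniusAlgHom F E).toRingHom.injective h')
    · intro x
      rw [← hy x x.2]
      simp [P, eval_finsetSum, ← pow_mul, pow_succ']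
    · rw [Module.card_eq_pow_finrank (K := F) (V := L)]
      refine lt_of_lt_of_le ?_ (Nat.pow_le_pow_right (by omega) hs)
      rw [← Nat.le_sub_one_iff_lt (by positivity)]
      refine natDegree_sum_le_of_forall_le _ _ fun ℓ _ => (natDegree_C_mul_X_pow_le _ _).trans ?_
      exact Nat.le_sub_one_of_lt (Nat.pow_lt_pow_right hq ℓ.2)
  funext ℓ
  have h := congrArg (fun p => p.coeff (Fintype.card F ^ ℓ.1)) hP
  simpa [P, finsetSum_coeff, coeff_C_mul, coeff_X_pow, (Nat.pow_right_injective hq).eq_iff,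
    Fin.val_inj] using h

/-- The Moore matrix with entries `w j ^ q ^ (ℓ + 1)`, where `q` is the cardinality of `F`. -/
def mooreMatrix (F : Type*) {E ι : Type*} [Fintype F] [Field E] (s : ℕ) (w : ι → E) :
    Matrix (Fin s) ι E :=
  Matrix.of fun ℓ j => w j ^ Fintype.card F ^ (ℓ.1 + 1)

theorem sum_smul_pow_card_pow {F E ι : Type*} [Field F] [Fintype F] [Field E] [Algebra F E]
    [Fintype ι] (c : ι → F) (x : ι → E) (n : ℕ) :
    (∑ i, c i • x i) ^ Fintype.card F ^ n = ∑ i, c i • x i ^ Fintype.card F ^ n := by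
  have h : ∀ z : E, (FiniteField.frobeniusAlgHom F E ^ n) z = z ^ Fintype.card F ^ n := by
    intro z
    rw [AlgHom.coe_pow, FiniteField.coe_frobeniusAlgHom, pow_iterate]
  simp only [← h, map_sum, map_smul]

theorem mooreMatrix_linearIndependent_row {F E ι : Type*} [Field F] [Fintype F] [Field E]
    [Fintype E] [Algebra F E] [Fintype ι] {s : ℕ} (w : ι → E)
    (hs : s ≤ Module.finrank F (Submodule.span F (Set.range w))) :
    LinearIndependent E (mooreMatrix F s w).row := by
  rw [← Matrix.vecMul_injective_iff, ← Matrix.coe_vecMulLinear,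
    ← LinearMap.ker_eq_bot, LinearMap.ker_eq_bot']
  intro y hy
  refine eq_zero_of_linearized_vanish _ hs y fun x hx => ?_
  obtain ⟨c, rfl⟩ := (Submodule.mem_span_range_iff_exists_fun F).1 hx
  have hy' : ∀ j, ∑ ℓ, y ℓ * w j ^ Fintype.card F ^ (ℓ.1 + 1) = 0 := fun j => congrFun hy j
  simp_rw [sum_smul_pow_card_pow, Finset.mul_sum, mul_smul_comm]
  rw [Finset.sum_comm]
  simp_rw [← Finset.smul_sum, hy', smul_zero, Finset.sum_const_zero]

theorem card_pow_mul_card_mooreMatrix_ker {F E : Type*} [Field F] [Fintype F] [Field E]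
    [Fintype E] [DecidableEq E] [Algebra F E] {s k : ℕ} (w : Fin k → E)
    (hs : s ≤ Module.finrank F (Submodule.span F (Set.range w))) :
    Fintype.card E ^ s * #{φ : Fin k → E | mooreMatrix F s w *ᵥ φ = 0} = Fintype.card E ^ k := by
  have hr := (mooreMatrix_linearIndependent_row w hs).rank_matrix
  have h := (mooreMatrix F s w).mulVecLin.finrank_range_add_finrank_ker
  rw [← Matrix.rank, hr, Fintype.card_fin, Module.finrank_fin_fun] at h
  have hc : #{φ : Fin k → E | mooreMatrix F s w *ᵥ φ = 0} =
      Nat.card (LinearMap.ker (mooreMatrix F s w).mulVecLin) := by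
    rw [Nat.subtype_card]
    simp
  rw [hc, Module.natCard_eq_pow_finrank (K := E), Nat.card_eq_fintype_card, ← pow_add, h]

theorem eq_zero_of_mooreMatrix_mulVec {F E ι : Type*} [Field F] [Fintype F] [Field E] [Fintype E]
    [Algebra F E] [Fintype ι] {s : ℕ} (w φ : ι → E)
    (hs : Module.finrank F (Submodule.span F (Set.range w)) ≤ s)
    (hφ : LinearIndependent F φ) (h : mooreMatrix F s w *ᵥ φ = 0) : w = 0 := by
  classical
  set L := Submodule.span F (Set.range w)
  set t := Module.finrank F L with ht
  let b := Module.finBasis F L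
  let c : ι → Fin t → F := fun j a => b.repr ⟨w j, Submodule.subset_span ⟨j, rfl⟩⟩ a
  have hw : ∀ j, w j = ∑ a, c j a • (b a : E) := by
    intro j
    have h := congrArg L.subtype (b.sum_repr ⟨w j, Submodule.subset_span ⟨j, rfl⟩⟩)
    rw [map_sum] at h
    exact h.symm
  let β : Fin t → E := fun a => b a
  have hβ : LinearIndependent F β := b.linearIndependent.map' L.subtype (Submodule.ker_subtype L)
  have hunit : IsUnit (mooreMatrix F t β) := by
    rw [← Matrix.linearIndependent_rows_iff_isUnit]
    apply mooreMatrix_linearIndependent_row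
    rw [finrank_span_eq_card hβ, Fintype.card_fin]
  have hx : (fun a => ∑ j, c j a • φ j) = 0 := by
    refine Matrix.mulVec_injective_iff_isUnit.2 hunit ?_
    rw [Matrix.mulVec_zero]
    funext ℓ
    have hℓ := congrFun h ⟨ℓ.1, ℓ.2.trans_le hs⟩
    simp only [Matrix.mulVec, dotProduct, mooreMatrix, Matrix.of_apply, Pi.zero_apply] at hℓ ⊢
    rw [← hℓ]
    simp_rw [hw, sum_smul_pow_card_pow, Finset.mul_sum, Finset.sum_mul]
    rw [Finset.sum_comm]
    simp [β]
  have hc : ∀ a j, c j a = 0 := fun a =>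
    Fintype.linearIndependent_iff.1 hφ _ (congrFun hx a)
  funext j
  rw [hw j]
  simp [hc]

theorem card_mul_card_not_linearIndependent_le {F E : Type*} [Field F] [Fintype F] [Field E]
    [Fintype E] [DecidableEq E] [Algebra F E] (k : ℕ)
    [DecidablePred fun φ : Fin k → E => LinearIndependent F φ] :
    Fintype.card E * #{φ : Fin k → E | ¬ LinearIndependent F φ} ≤
      Fintype.card F ^ k * Fintype.card E ^ k := by
  classical
  let K : (Fin k → F) → Finset (Fin k → E) := fun c => {φ | ∑ j, c j • φ j = 0}
  have hsub : ({φ : Fin k → E | ¬ LinearIndependent F φ} : Finset _) ⊆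
      (univ.filter fun c : Fin k → F => c ≠ 0).biUnion K := by
    intro φ hφ
    simp only [mem_filter, mem_univ, true_and, Fintype.linearIndependent_iff, not_forall] at hφ
    obtain ⟨c, hc, j, hj⟩ := hφ
    simp only [mem_biUnion, mem_filter, mem_univ, true_and, K]
    exact ⟨c, fun h => hj (congrFun h j), hc⟩
  have hK : ∀ c : Fin k → F, c ≠ 0 → Fintype.card E * #(K c) ≤ Fintype.card E ^ k := by
    intro c hc
    obtain ⟨j, hj⟩ := Function.ne_iff.1 hc
    rw [Pi.zero_apply] at hj
    let T : (Fin k → E) →ₗ[E] E :=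
      Fintype.linearCombination E (fun i => algebraMap F E (c i))
    have hT : ∀ φ, T φ = ∑ i, c i • φ i := fun φ => by
      simp [T, Fintype.linearCombination_apply, Algebra.smul_def, mul_comm]
    have hsurj : LinearMap.range T = ⊤ := by
      rw [LinearMap.range_eq_top]
      intro e
      refine ⟨Pi.single j ((c j)⁻¹ • e), ?_⟩
      rw [hT, Finset.sum_eq_single j]
      · rw [Pi.single_eq_same, smul_inv_smul₀ hj]
      · intro i _ hi
        rw [Pi.single_eq_of_ne hi, smul_zero]
      · simp
    have h := T.finrank_range_add_finrank_ker
    rw [hsurj, finrank_top, Module.finrank_self, Module.finrank_fin_fun] at h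
    have hc' : #(K c) = Nat.card (LinearMap.ker T) := by
      rw [Nat.subtype_card]
      simp [K, hT]
    rw [hc', Module.natCard_eq_pow_finrank (K := E), Nat.card_eq_fintype_card, ← pow_succ',
      add_comm, h]
  calc Fintype.card E * #{φ : Fin k → E | ¬ LinearIndependent F φ}
      ≤ Fintype.card E * ∑ c : Fin k → F with c ≠ 0, #(K c) := by
        gcongr
        exact (card_le_card hsub).trans card_biUnion_le
    _ = ∑ c : Fin k → F with c ≠ 0, Fintype.card E * #(K c) := Finset.mul_sum _ _ _
    _ ≤ ∑ c : Fin k → F with c ≠ 0, Fintype.card E ^ k :=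
        Finset.sum_le_sum fun c hc => hK c (mem_filter.1 hc).2
    _ ≤ ∑ c : Fin k → F, Fintype.card E ^ k :=
        Finset.sum_le_sum_of_subset (filter_subset _ _)
    _ = Fintype.card F ^ k * Fintype.card E ^ k := by simp

/-- A first-moment argument: some linearly independent `φ` avoids the kernels of the Moore matrices
of all nonzero tuples of elements of `U`. -/
theorem exists_linearIndependent_avoiding_mooreMatrix_ker {F E : Type*} [Field F] [Fintype F]
    [Field E] [Fintype E] [Algebra F E] (s k : ℕ) (U : Submodule F E)
    (hk : 4 * Fintype.card F ^ k ≤ Fintype.card E)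
    (hs : 2 * Nat.card U ^ k ≤ Fintype.card E ^ s) :
    ∃ φ : Fin k → E, LinearIndependent F φ ∧
      ∀ w : Fin k → E, (∀ j, w j ∈ U) → mooreMatrix F s w *ᵥ φ = 0 → w = 0 := by
  classical
  rw [Nat.card_eq_fintype_card] at hs
  by_contra! hcon
  have hE : 0 < Fintype.card E := Fintype.card_pos
  let K : (Fin k → U) → Finset (Fin k → E) := fun w =>
    {φ | mooreMatrix F s (fun j => (w j : E)) *ᵥ φ = 0}
  let G : Finset (Fin k → U) :=
    {w | s ≤ Module.finrank F (Submodule.span F (Set.range fun j => (w j : E)))}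
  let D : Finset (Fin k → E) := {φ | ¬ LinearIndependent F φ}
  have hcover : (univ : Finset (Fin k → E)) ⊆ D ∪ G.biUnion K := by
    intro φ _
    rw [mem_union]
    by_cases hφ : LinearIndependent F φ
    · right
      obtain ⟨w, hwU, hw, hw0⟩ := hcon φ hφ
      refine mem_biUnion.2 ⟨fun j => ⟨w j, hwU j⟩, ?_, ?_⟩
      · simp only [G, mem_filter, mem_univ, true_and]
        by_contra! hlt
        exact hw0 (eq_zero_of_mooreMatrix_mulVec w φ hlt.le hφ hw)
      · simpa [K] using hw
    · left
      simpa [D] using hφ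
  have htot : Fintype.card E ^ k ≤ #D + #(G.biUnion K) := by
    have := (card_le_card hcover).trans (card_union_le _ _)
    simpa using this
  have hD : 4 * #D ≤ Fintype.card E ^ k := by
    have h1 : Fintype.card E * #D ≤ Fintype.card F ^ k * Fintype.card E ^ k :=
      card_mul_card_not_linearIndependent_le k
    have hF : 0 < Fintype.card F ^ k := pow_pos Fintype.card_pos k
    refine le_of_mul_le_mul_left (a := Fintype.card F ^ k) ?_ hF
    calc Fintype.card F ^ k * (4 * #D) = 4 * Fintype.card F ^ k * #D := by ring
      _ ≤ Fintype.card E * #D := by gcongr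
      _ ≤ _ := h1
  have hG : 2 * #(G.biUnion K) ≤ Fintype.card E ^ k := by
    have hU : 0 < Fintype.card U ^ k := pow_pos Fintype.card_pos k
    refine le_of_mul_le_mul_left (a := Fintype.card U ^ k) ?_ hU
    calc Fintype.card U ^ k * (2 * #(G.biUnion K))
        = 2 * Fintype.card U ^ k * #(G.biUnion K) := by ring
      _ ≤ Fintype.card E ^ s * ∑ w ∈ G, #(K w) := Nat.mul_le_mul hs card_biUnion_le
      _ = ∑ w ∈ G, Fintype.card E ^ s * #(K w) := Finset.mul_sum _ _ _
      _ = ∑ w ∈ G, Fintype.card E ^ k :=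
          Finset.sum_congr rfl fun w hw => card_pow_mul_card_mooreMatrix_ker _ (mem_filter.1 hw).2
      _ ≤ ∑ w : Fin k → U, Fintype.card E ^ k :=
          Finset.sum_le_sum_of_subset (filter_subset _ _)
      _ = Fintype.card U ^ k * Fintype.card E ^ k := by simp
  have : 0 < Fintype.card E ^ k := pow_pos hE k
  omega

theorem traceDual_eq_orthogonal {F E : Type*} [Field F] [Fintype F] [Field E] [Fintype E]
    [Algebra F E] (q m : ℕ) (hq : Fintype.card F = q) (hm : Module.finrank F E = m)
    (V : Submodule F E) :
    traceDual q m hq V = (Algebra.traceForm F E).orthogonal V := by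
  subst hq hm
  ext x
  change (∀ v ∈ V, _ = _) ↔ ∀ v ∈ V, Algebra.traceForm F E v x = 0
  refine forall₂_congr fun v _ => ?_
  rw [Algebra.traceForm_apply, ← (algebraMap F E).injective.eq_iff, map_zero,
    FiniteField.algebraMap_trace_eq_sum_pow, Nat.card_eq_fintype_card]

/-- If `q = 2`, `1 ≤ s < d ≤ m`, `2 ≤ r ≤ m`, and `ms ≥ d(m-r) + 1`, then for
every `F_2`-subspace `U ⊆ F_{2^m}` of dimension `d` there exists an `F_2`-subspace
`V ⊆ F_{2^m}` of dimension `r` such that `(U, V)` is a good pair. -/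
theorem stmt_10 {F E : Type*} [Field F] [Fintype F] [Field E] [Fintype E] [Algebra F E]
    (q m s d r : ℕ) (hq : Fintype.card F = q) (hq2 : q = 2) (hm : Module.finrank F E = m)
    (hs1 : 1 ≤ s) (hsd : s < d) (hdm : d ≤ m) (hr2 : 2 ≤ r) (hrm : r ≤ m)
    (hms : d * (m - r) + 1 ≤ m * s)
    (U : Submodule F E) (hU : Module.finrank F U = d) :
    ∃ V : Submodule F E, Module.finrank F V = r ∧ IsGoodPair q m s hq U V := by
  subst hq2
  obtain ⟨φ, hφ, hgood⟩ := exists_linearIndependent_avoiding_mooreMatrix_ker s (m - r) U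
    (by
      rw [Module.card_eq_pow_finrank (K := F) (V := E), hq, hm]
      calc 4 * 2 ^ (m - r) = 2 ^ (2 + (m - r)) := by rw [pow_add]; rfl
        _ ≤ 2 ^ m := Nat.pow_le_pow_right (by norm_num) (by omega))
    (by
      rw [Module.card_eq_pow_finrank (K := F) (V := E),
        Module.natCard_eq_pow_finrank (K := F) (V := U), Nat.card_eq_fintype_card, hq,
        hm, hU, ← pow_mul, ← pow_mul,
        ← pow_succ']
      exact Nat.pow_le_pow_right (by norm_num) hms)
  let W : Submodule F E := Submodule.span F (Set.range φ)
  have hW : Module.finrank F W = m - r := by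
    rw [finrank_span_eq_card hφ, Fintype.card_fin]
  have hB : (Algebra.traceForm F E).Nondegenerate := traceForm_nondegenerate F E
  have hV : Module.finrank F ((Algebra.traceForm F E).orthogonal W) = r := by
    rw [LinearMap.BilinForm.finrank_orthogonal hB, hm, hW]
    omega
  refine ⟨(Algebra.traceForm F E).orthogonal W, hV, ?_, ?_⟩
  · rw [hU, hV]
    omega
  · intro u huU hu _ v' hv' hsum
    rw [traceDual_eq_orthogonal 2 m hq hm, LinearMap.BilinForm.orthogonal_orthogonal hB
      (Algebra.traceForm_isSymm F).isRefl] at hv'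
    choose c hc using fun i => (Submodule.mem_span_range_iff_exists_fun F).1 (hv' i)
    have hw : (fun j => ∑ i, c i j • u i) = 0 := by
      refine hgood _ (fun j => U.sum_mem fun i _ => U.smul_mem _ (huU i)) ?_
      funext ℓ
      rw [Pi.zero_apply, ← hsum (ℓ.1 + 1) (by omega) (by omega)]
      simp only [Matrix.mulVec, dotProduct, mooreMatrix, Matrix.of_apply, sum_smul_pow_card_pow]
      simp only [hq, ← hc, Finset.sum_mul]
      rw [Finset.sum_comm]
      refine Finset.sum_congr rfl fun i _ => Finset.sum_congr rfl fun j _ => ?_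
      rw [smul_mul_assoc, smul_mul_assoc, mul_comm]
    intro i
    rw [← hc i]
    refine Finset.sum_eq_zero fun j _ => ?_
    rw [Fintype.linearIndependent_iff.1 hu (fun i => c i j) (congrFun hw j) i, zero_smul]
end
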